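/- The map p⁺ sending a hyperbolic element of a complex unital Banach algebra to its positive spectral projector is a homotopy equivalence between the space of hyperbolic elements and the space of idempotents, with homotopy inverse p ↦ 2p - 1. -/

import Mathlib

open Complex

/-- The Riesz projector defined by the contour integral `(1/2πi) ∮ (z - x)⁻¹ dz` over the
circle of center `c` and radius `r`. -/
noncomputable def rieszProjector {A : Type*} [NormedRing A] [NormedAlgebra ℂ A]
    (x : A) (c : ℂ) (r : ℝ) : A :=
  (2 * (Real.pi : ℂ) * Complex.I)⁻¹ • ∮ z in C(c, r), resolvent x z

open Classical in
/-- The positive spectral projector `p⁺(x)`: the Riesz projector of `x` over a simple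
closed curve enclosing exactly the part of the spectrum in the open right half-plane. -/
noncomputable def posProj {A : Type*} [NormedRing A] [NormedAlgebra ℂ A] (x : A) : A :=
  if h : ∃ c r : ℝ, 0 < r ∧
      spectrum ℂ x ∩ {z : ℂ | 0 < z.re} ⊆ Metric.ball (c : ℂ) r ∧
      Disjoint (spectrum ℂ x ∩ {z : ℂ | z.re ≤ 0}) (Metric.closedBall (c : ℂ) r)
  then rieszProjector x (h.choose : ℂ) h.choose_spec.choose
  else 0

open Classical in
/-- The negative spectral projector `p⁻(x)`: the Riesz projector of `x` over a simple
closed curve enclosing exactly the part of the spectrum in the open left half-plane. -/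
noncomputable def negProj {A : Type*} [NormedRing A] [NormedAlgebra ℂ A] (x : A) : A :=
  if h : ∃ c r : ℝ, 0 < r ∧
      spectrum ℂ x ∩ {z : ℂ | z.re < 0} ⊆ Metric.ball (c : ℂ) r ∧
      Disjoint (spectrum ℂ x ∩ {z : ℂ | 0 ≤ z.re}) (Metric.closedBall (c : ℂ) r)
  then rieszProjector x (h.choose : ℂ) h.choose_spec.choose
  else 0

/-- The set of hyperbolic elements of a Banach algebra. -/
def hypSet (A : Type*) [NormedRing A] [NormedAlgebra ℂ A] : Set A :=
  {x : A | spectrum ℂ x ∩ {z : ℂ | z.re = 0} = ∅}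

/-- The set of idempotents of a Banach algebra. -/
def idemSet (A : Type*) [NormedRing A] [NormedAlgebra ℂ A] : Set A :=
  {p : A | p * p = p}

theorem IsIdempotentElem.mul_add_compl_mul {R : Type*} [Ring R] {p a b : R}
    (hp : IsIdempotentElem p) (hb : Commute b p) :
    (a * p + (1 - p)) * (b * p + (1 - p)) = a * b * p + (1 - p) := by
  simp only [mul_add, add_mul, mul_sub, sub_mul, mul_assoc, mul_one, one_mul, hp.eq,
    hb.symm.left_comm]
  abel

theorem IsIdempotentElem.isUnit_mul_add_compl {R : Type*} [Ring R] {p a b : R}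
    (hp : IsIdempotentElem p) (ha : Commute a p) (hb : Commute b p)
    (hab : a * b * p = p) (hba : b * a * p = p) : IsUnit (a * p + (1 - p)) :=
  isUnit_iff_exists.2 ⟨b * p + (1 - p), by rw [hp.mul_add_compl_mul hb, hab]; abel,
    by rw [hp.mul_add_compl_mul ha, hba]; abel⟩

theorem IsUnit.mul_add_compl {R : Type*} [Ring R] {p v : R} (hv : IsUnit v)
    (hp : IsIdempotentElem p) (hvp : Commute v p) : IsUnit (v * p + (1 - p)) := by
  obtain ⟨u, rfl⟩ := hv
  exact hp.isUnit_mul_add_compl hvp hvp.units_inv_left (by simp) (by simp)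

theorem IsIdempotentElem.corner_mul_corner {R : Type*} [Ring R] {p a b : R}
    (hp : IsIdempotentElem p) (ha : Commute a p) :
    (b * p + (1 - p)) * (a * (1 - p) + p) = b * p + a * (1 - p) := by
  simp only [mul_add, add_mul, mul_sub, sub_mul, mul_assoc, mul_one, one_mul, hp.eq,
    ha.symm.left_comm, ha.symm.eq]
  abel

theorem Commute.ringInverse_right {M₀ : Type*} [MonoidWithZero M₀] {a b : M₀} (h : Commute a b) :
    Commute a (Ring.inverse b) := by
  by_cases hb : IsUnit b
  · obtain ⟨u, rfl⟩ := hb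
    rw [Ring.inverse_unit]
    exact h.units_inv_right
  · rw [Ring.inverse_non_unit _ hb]
    exact Commute.zero_right a

/-- If every `w - x` is invertible relative to an idempotent `q` commuting with `x`, then
`q = 0`: a nonzero corner of a complex Banach algebra has nonempty spectrum. -/
theorem eq_zero_of_forall_isUnit_corner {A : Type*} [NormedRing A] [NormedAlgebra ℂ A]
    [CompleteSpace A] {x q : A} (hq : IsIdempotentElem q) (hx : Commute x q)
    (h : ∀ w : ℂ, IsUnit ((algebraMap ℂ A w - x) * q + (1 - q))) : q = 0 := by
  set V : ℂ → A := fun w => (algebraMap ℂ A w - x) * q + (1 - q) with hV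
  set F : ℂ → A := fun w => Ring.inverse (V w) * q with hF
  have hd : Differentiable ℂ F := by
    intro w
    refine DifferentiableAt.mul_const ?_ q
    refine DifferentiableAt.comp (g := Ring.inverse) w (differentiableAt_inverse (h w)) ?_
    have : Differentiable ℂ fun w : ℂ => algebraMap ℂ A w := by
      simp only [Algebra.algebraMap_eq_smul_one]; fun_prop
    fun_prop
  have hlim : Filter.Tendsto F (Filter.cocompact ℂ) (nhds 0) := by
    have h1 := (spectrum.resolvent_tendsto_cobounded (𝕜 := ℂ) (x * q)).mul_const q
    rw [zero_mul, Metric.cobounded_eq_cocompact] at h1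
    refine h1.congr' ?_
    have h2 : ∀ᶠ w in Filter.cocompact ℂ, w ∈ resolventSet ℂ (x * q) := by
      filter_upwards [(spectrum.isCompact (𝕜 := ℂ) (x * q)).compl_mem_cocompact] with w hw
      simpa [spectrum] using hw
    filter_upwards [h2] with w hw
    have hw' : IsUnit (algebraMap ℂ A w - x * q) := hw
    have e1 : V w * q = (algebraMap ℂ A w - x * q) * q := by
      simp only [hV, add_mul, sub_mul, mul_assoc, one_mul, hq.eq, sub_self, add_zero]
    have e2 : Commute q (algebraMap ℂ A w - x * q) :=
      ((Algebra.commute_algebraMap_left w q).sub_left (hx.mul_left (Commute.refl q))).symm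
    have e3 : F w * (algebraMap ℂ A w - x * q) = q := by
      simp only [hF]
      rw [mul_assoc, e2.eq, ← e1, Ring.inverse_mul_cancel_left _ _ (h w)]
    change Ring.inverse _ * q = _
    rw [← e2.ringInverse_right.eq]
    nth_rw 1 [← e3]
    rw [Ring.mul_inverse_cancel_right _ _ hw']
  have h0 : F 0 = 0 := hd.apply_eq_of_tendsto_cocompact 0 hlim
  calc q = V 0 * F 0 := by simp only [hF]; rw [Ring.mul_inverse_cancel_left _ _ (h 0)]
    _ = 0 := by rw [h0, mul_zero]

/-- `IsPosSpectralProj x p` says that `p` is an idempotent commuting with `x` which splits the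
spectrum of `x` along the imaginary axis, the part of `x` in the corner of `p` having spectrum in
the open right half-plane and the complementary part in the open left half-plane. -/
structure IsPosSpectralProj {A : Type*} [NormedRing A] [NormedAlgebra ℂ A] (x p : A) : Prop where
  idem : IsIdempotentElem p
  comm : Commute x p
  isUnit_pos : ∀ w : ℂ, w.re ≤ 0 → IsUnit ((algebraMap ℂ A w - x) * p + (1 - p))
  isUnit_neg : ∀ w : ℂ, 0 ≤ w.re → IsUnit ((algebraMap ℂ A w - x) * (1 - p) + p)

namespace IsPosSpectralProj

variable {A : Type*} [NormedRing A] [NormedAlgebra ℂ A] {x p p' : A}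

theorem commute_algebraMap_sub (h : IsPosSpectralProj x p) (w : ℂ) :
    Commute (algebraMap ℂ A w - x) p :=
  (Algebra.commute_algebraMap_left w p).sub_left h.comm

theorem mul_compl_eq_zero [CompleteSpace A] (h : IsPosSpectralProj x p)
    (h' : IsPosSpectralProj x p') (hc : Commute p p') : p * (1 - p') = 0 := by
  have hc' : Commute p (1 - p') := (Commute.one_right p).sub_right hc
  have hq : IsIdempotentElem (p * (1 - p')) := h.idem.mul_of_commute hc' h'.idem.one_sub
  refine eq_zero_of_forall_isUnit_corner (x := x) hq (h.comm.mul_right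
    ((Commute.one_right x).sub_right h'.comm)) fun w => ?_
  have e : Commute (algebraMap ℂ A w - x) (p * (1 - p')) :=
    (h.commute_algebraMap_sub w).mul_right
      ((Commute.one_right _).sub_right (h'.commute_algebraMap_sub w))
  rcases le_total w.re 0 with hw | hw
  · have hp : p * (p * (1 - p')) = p * (1 - p') := by rw [← mul_assoc, h.idem.eq]
    have := (h.isUnit_pos w hw).mul_add_compl hq
      ((e.mul_left ((Commute.refl p).mul_right hc')).add_left
        ((Commute.one_left _).sub_left ((Commute.refl p).mul_right hc')))
    convert this using 2
    rw [add_mul, sub_mul 1, mul_assoc _ p, hp, one_mul, sub_self, add_zero]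
  · have hp : p' * (p * (1 - p')) = 0 := by
      rw [← mul_assoc, ← hc.eq, mul_assoc, mul_sub, mul_one, h'.idem.eq, sub_self, mul_zero]
    have hp' : Commute p' (p * (1 - p')) :=
      hc.symm.mul_right ((Commute.one_right p').sub_right (Commute.refl p'))
    have := (h'.isUnit_neg w hw).mul_add_compl hq
      ((e.mul_left ((Commute.one_left _).sub_left hp')).add_left hp')
    convert this using 2
    rw [add_mul, mul_assoc, sub_mul 1, hp, one_mul, sub_zero, add_zero]

theorem eq_of_commute [CompleteSpace A] (h : IsPosSpectralProj x p)
    (h' : IsPosSpectralProj x p') (hc : Commute p p') : p = p' := by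
  have e1 := h.mul_compl_eq_zero h' hc
  have e2 := h'.mul_compl_eq_zero h hc.symm
  rw [mul_sub, mul_one, sub_eq_zero] at e1 e2
  rw [e1, hc.eq, ← e2]

theorem two_smul_sub_one (hp : IsIdempotentElem p) : IsPosSpectralProj ((2 : ℂ) • p - 1) p := by
  refine ⟨hp, ((Commute.refl p).smul_left 2).sub_left (Commute.one_left p),
    fun w hw => ?_, fun w hw => ?_⟩
  · have hw' : w - 1 ≠ 0 := fun h => by
      have := congrArg Complex.re h; simp at this; linarith
    have := ((isUnit_iff_ne_zero.2 hw').map (algebraMap ℂ A)).mul_add_compl hp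
      (Algebra.commutes _ _)
    convert this using 2
    simp only [two_smul, map_sub, map_one, sub_mul, add_mul, hp.eq, one_mul]
    abel
  · have hw' : w + 1 ≠ 0 := fun h => by
      have := congrArg Complex.re h; simp at this; linarith
    have := ((isUnit_iff_ne_zero.2 hw').map (algebraMap ℂ A)).mul_add_compl hp.one_sub
      (Algebra.commutes _ _)
    convert this using 1
    simp only [two_smul, map_add, map_one, sub_mul, add_mul, mul_sub, hp.eq, one_mul, mul_one]
    abel

theorem isUnit_sub_segment (h : IsPosSpectralProj x p) {t : ℝ} (ht0 : 0 ≤ t) (ht1 : t ≤ 1)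
    {z : ℂ} (hz : z.re = 0) :
    IsUnit (algebraMap ℂ A z - (((1 - t : ℝ) : ℂ) • x + (t : ℂ) • ((2 : ℂ) • p - 1))) := by
  rcases ht1.eq_or_lt with rfl | ht
  · have h2 := two_smul_sub_one h.idem
    have u := (h2.isUnit_pos z hz.le).mul (h2.isUnit_neg z hz.ge)
    rw [h.idem.corner_mul_corner (h2.commute_algebraMap_sub z), ← mul_add, add_sub_cancel,
      mul_one] at u
    simpa using u
  · set s : ℝ := 1 - t with hs
    have hs0 : 0 < s := by linarith
    have ht' : (s : ℂ) ≠ 0 := by exact_mod_cast hs0.ne'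
    have u1 := h.isUnit_pos ((z - t) / s) (by
      rw [Complex.div_ofReal_re]
      simp only [Complex.sub_re, hz, Complex.ofReal_re, zero_sub]
      exact div_nonpos_of_nonpos_of_nonneg (by linarith) hs0.le)
    have u2 := h.isUnit_neg ((z + t) / s) (by
      rw [Complex.div_ofReal_re]
      simp only [Complex.add_re, hz, Complex.ofReal_re, zero_add]
      exact div_nonneg ht0 hs0.le)
    have u3 := (isUnit_iff_ne_zero.2 ht').map (algebraMap ℂ A)
    have e1 : algebraMap ℂ A s * (algebraMap ℂ A ((z - t) / s) - x)
        = algebraMap ℂ A z - algebraMap ℂ A t - algebraMap ℂ A s * x := by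
      rw [mul_sub, ← map_mul, mul_div_cancel₀ _ ht', map_sub]
    have e2 : algebraMap ℂ A s * (algebraMap ℂ A ((z + t) / s) - x)
        = algebraMap ℂ A z + algebraMap ℂ A t - algebraMap ℂ A s * x := by
      rw [mul_sub, ← map_mul, mul_div_cancel₀ _ ht', map_add]
    convert u3.mul (u1.mul u2) using 1
    rw [h.idem.corner_mul_corner (h.commute_algebraMap_sub _), mul_add, ← mul_assoc, ← mul_assoc,
      e1, e2]
    simp only [Algebra.smul_def (t : ℂ), Algebra.smul_def (s : ℂ), two_smul, mul_add, add_mul,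
      mul_sub, sub_mul, mul_one, mul_assoc]
    abel

end IsPosSpectralProj

section Riesz

open Metric

theorem ContinuousLinearMap.circleIntegral_comp_comm {E F : Type*} [NormedAddCommGroup E]
    [NormedSpace ℂ E] [CompleteSpace E] [NormedAddCommGroup F] [NormedSpace ℂ F] [CompleteSpace F]
    (L : E →L[ℂ] F) {f : ℂ → E} {c : ℂ} {r : ℝ} (hf : CircleIntegrable f c r) :
    ∮ z in C(c, r), L (f z) = L (∮ z in C(c, r), f z) := by
  simp only [circleIntegral, ← L.map_smul]
  exact L.intervalIntegral_comp_comm hf.out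

theorem circleIntegral_circleIntegral_swap {E : Type*} [NormedAddCommGroup E]
    [NormedSpace ℂ E] {f : ℂ → ℂ → E} {c c' : ℂ} {r r' : ℝ} (hr : 0 ≤ r) (hr' : 0 ≤ r')
    (hf : ContinuousOn (Function.uncurry f) (sphere c r ×ˢ sphere c' r')) :
    ∮ z in C(c, r), ∮ w in C(c', r'), f z w = ∮ w in C(c', r'), ∮ z in C(c, r), f z w := by
  simp only [circleIntegral, ← intervalIntegral.integral_smul]
  have hcont : Continuous fun t : ℝ × ℝ => f (circleMap c r t.1) (circleMap c' r' t.2) :=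
    hf.comp_continuous (f := fun t : ℝ × ℝ => (circleMap c r t.1, circleMap c' r' t.2))
      (by fun_prop) fun t => ⟨circleMap_mem_sphere c hr _, circleMap_mem_sphere c' hr' _⟩
  rw [MeasureTheory.intervalIntegral_intervalIntegral_swap]
  · simp only [smul_comm (deriv (circleMap c r) _)]
  · have : Continuous fun t : ℝ × ℝ => deriv (circleMap c r) t.1 •
        deriv (circleMap c' r') t.2 • f (circleMap c r t.1) (circleMap c' r' t.2) := by
      simp only [deriv_circleMap]
      exact (show Continuous fun t : ℝ × ℝ => circleMap 0 r t.1 * Complex.I by fun_prop).smul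
        ((show Continuous fun t : ℝ × ℝ => circleMap 0 r' t.2 * Complex.I by fun_prop).smul hcont)
    exact (this.continuousOn.integrableOn_compact
      (isCompact_uIcc.prod isCompact_uIcc)).mono_set
      (Set.prod_mono Set.uIoc_subset_uIcc Set.uIoc_subset_uIcc)

theorem Commute.resolvent_right {A : Type*} [NormedRing A] [NormedAlgebra ℂ A] {x b : A}
    (h : Commute b x) (z : ℂ) :
    Commute b (resolvent x z) :=
  (((Algebra.commute_algebraMap_right z b).sub_right h)).ringInverse_right

variable {A : Type*} [NormedRing A] [NormedAlgebra ℂ A] [CompleteSpace A]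

theorem continuousOn_resolvent (x : A) : ContinuousOn (resolvent x) (resolventSet ℂ x) :=
  fun _ hz => (spectrum.hasDerivAt_resolvent_const_left hz).continuousAt.continuousWithinAt

theorem Commute.circleIntegral_right {b : A} {f : ℂ → A} {c : ℂ} {r : ℝ}
    (h : ∀ z, Commute b (f z)) : Commute b (∮ z in C(c, r), f z) := by
  by_cases hf : CircleIntegrable f c r
  · have h1 := (ContinuousLinearMap.mul ℂ A b).circleIntegral_comp_comm hf
    have h2 := ((ContinuousLinearMap.mul ℂ A).flip b).circleIntegral_comp_comm hf
    simp only [ContinuousLinearMap.mul_apply', ContinuousLinearMap.flip_apply] at h1 h2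
    simp only [(h _).eq] at h1
    exact h1.symm.trans h2
  · rw [circleIntegral.integral_undef hf]
    exact Commute.zero_right b

theorem Commute.rieszProjector_right {x b : A} (h : Commute b x) (c : ℂ) (r : ℝ) :
    Commute b (rieszProjector x c r) :=
  (Commute.circleIntegral_right fun z => h.resolvent_right z).smul_right _

/-- The Cauchy transform `(1/2πi) ∮ (w - z)⁻¹ (z - x)⁻¹ dz` of the resolvent of `x`. -/
noncomputable def resolventCauchyTransform (x : A) (c : ℂ) (r : ℝ) (w : ℂ) : A :=
  (2 * (Real.pi : ℂ) * Complex.I)⁻¹ • ∮ z in C(c, r), (w - z)⁻¹ • resolvent x z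

theorem Commute.resolventCauchyTransform_right {x b : A} (h : Commute b x) (c : ℂ) (r : ℝ)
    (w : ℂ) : Commute b (resolventCauchyTransform x c r w) :=
  (Commute.circleIntegral_right fun z => (h.resolvent_right z).smul_right _).smul_right _

variable {x : A} {c w : ℂ} {r : ℝ}

theorem circleIntegrable_resolvent (hr : 0 ≤ r) (hs : sphere c r ⊆ resolventSet ℂ x) :
    CircleIntegrable (resolvent x) c r :=
  ((continuousOn_resolvent x).mono hs).circleIntegrable hr

theorem continuousOn_const_sub_inv (hw : w ∉ sphere c r) :
    ContinuousOn (fun z => (w - z)⁻¹) (sphere c r) :=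
  (continuousOn_const.sub continuousOn_id).inv₀ fun z hz h =>
    hw ((sub_eq_zero.1 h : w = z) ▸ hz)

theorem sub_mul_resolventCauchyTransform (hr : 0 ≤ r) (hs : sphere c r ⊆ resolventSet ℂ x)
    (hw : w ∉ sphere c r) :
    (algebraMap ℂ A w - x) * resolventCauchyTransform x c r w = rieszProjector x c r +
      ((2 * (Real.pi : ℂ) * Complex.I)⁻¹ * ∮ z in C(c, r), (w - z)⁻¹) • (1 : A) := by
  have hint : CircleIntegrable (fun z => (w - z)⁻¹ • resolvent x z) c r :=
    ((continuousOn_const_sub_inv hw).smul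
      ((continuousOn_resolvent x).mono hs)).circleIntegrable hr
  have hint' : CircleIntegrable (fun z => (w - z)⁻¹ • (1 : A)) c r :=
    ((continuousOn_const_sub_inv hw).smul continuousOn_const).circleIntegrable hr
  have h1 := (ContinuousLinearMap.mul ℂ A (algebraMap ℂ A w - x)).circleIntegral_comp_comm hint
  simp only [ContinuousLinearMap.mul_apply'] at h1
  rw [resolventCauchyTransform, mul_smul_comm, ← h1, rieszProjector, mul_smul, ← smul_add,
    ← circleIntegral.integral_smul_const, ← circleIntegral.integral_add
      (circleIntegrable_resolvent hr hs) hint']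
  congr 1
  refine circleIntegral.integral_congr hr fun z hz => ?_
  have hz' : IsUnit (algebraMap ℂ A z - x) := hs hz
  have hwz : w - z ≠ 0 := fun h => hw ((sub_eq_zero.1 h : w = z) ▸ hz)
  have e : algebraMap ℂ A w - x = (w - z) • (1 : A) + (algebraMap ℂ A z - x) := by
    rw [← Algebra.algebraMap_eq_smul_one, map_sub]; abel
  rw [mul_smul_comm, e, add_mul, resolvent, Ring.mul_inverse_cancel _ hz', smul_mul_assoc, one_mul,
    smul_add, inv_smul_smul₀ hwz]

theorem circleIntegral_const_sub_inv_of_mem_ball (hw : w ∈ ball c r) :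
    ∮ z in C(c, r), (w - z)⁻¹ = -(2 * (Real.pi : ℂ) * Complex.I) := by
  rw [← circleIntegral.integral_sub_inv_of_mem_ball hw, ← neg_one_mul,
    ← circleIntegral.integral_const_mul]
  congr 1
  ext z
  rw [← neg_sub z w, inv_neg, neg_one_mul]

theorem circleIntegral_const_sub_inv_of_notMem_closedBall (hr : 0 ≤ r)
    (hw : w ∉ closedBall c r) : ∮ z in C(c, r), (w - z)⁻¹ = 0 := by
  have hne : ∀ z ∈ closedBall c r, w - z ≠ 0 := fun z hz h =>
    hw ((sub_eq_zero.1 h : w = z) ▸ hz)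
  refine Complex.circleIntegral_eq_zero_of_differentiable_on_off_countable hr
    Set.countable_empty ?_ fun z hz => ?_
  · exact (continuousOn_const.sub continuousOn_id).inv₀ hne
  · exact ((differentiableAt_const w).sub differentiableAt_id).inv
      (hne z (ball_subset_closedBall hz.1))

theorem sub_mul_resolventCauchyTransform_of_notMem_closedBall (hr : 0 ≤ r)
    (hs : sphere c r ⊆ resolventSet ℂ x) (hw : w ∉ closedBall c r) :
    (algebraMap ℂ A w - x) * resolventCauchyTransform x c r w = rieszProjector x c r := by
  rw [sub_mul_resolventCauchyTransform hr hs fun h => hw (sphere_subset_closedBall h),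
    circleIntegral_const_sub_inv_of_notMem_closedBall hr hw, mul_zero, zero_smul, add_zero]

theorem sub_mul_resolventCauchyTransform_of_mem_ball (hr : 0 ≤ r)
    (hs : sphere c r ⊆ resolventSet ℂ x) (hw : w ∈ ball c r) :
    (algebraMap ℂ A w - x) * resolventCauchyTransform x c r w = rieszProjector x c r - 1 := by
  rw [sub_mul_resolventCauchyTransform hr hs fun h => (mem_sphere.1 h).not_lt (mem_ball.1 hw),
    circleIntegral_const_sub_inv_of_mem_ball hw, mul_neg,
    inv_mul_cancel₀ Complex.two_pi_I_ne_zero, neg_one_smul, sub_eq_add_neg]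

theorem exists_closedBall_diff_ball_subset (hr : 0 < r) {U : Set ℂ} (hU : IsOpen U)
    (hs : sphere c r ⊆ U) : ∃ r' > r, closedBall c r' \ ball c r ⊆ U := by
  obtain ⟨δ, hδ, h⟩ := (isCompact_sphere c r).exists_cthickening_subset_open hU hs
  refine ⟨r + δ, by linarith, fun z hz => h ?_⟩
  obtain ⟨hz1, hz2⟩ := hz
  rw [mem_closedBall, dist_eq_norm] at hz1
  rw [mem_ball, dist_eq_norm, not_lt] at hz2
  have hn : 0 < ‖z - c‖ := hr.trans_le hz2
  have hn' : (‖z - c‖ : ℂ) ≠ 0 := by exact_mod_cast hn.ne'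
  refine mem_cthickening_of_dist_le z (c + (r / ‖z - c‖ : ℝ) • (z - c)) δ _ ?_ ?_
  · rw [mem_sphere, dist_eq_norm, add_sub_cancel_left, norm_smul,
      Real.norm_of_nonneg (by positivity), div_mul_cancel₀ _ hn.ne']
  · have e : z - (c + (r / ‖z - c‖ : ℝ) • (z - c)) = (1 - r / ‖z - c‖ : ℝ) • (z - c) := by
      rw [sub_smul, one_smul]; abel
    rw [dist_eq_norm, e, norm_smul, Real.norm_of_nonneg
      (sub_nonneg.2 ((div_le_one hn).2 hz2)), sub_mul, one_mul, div_mul_cancel₀ _ hn.ne']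
    linarith

theorem isIdempotentElem_rieszProjector (hr : 0 < r) (hs : sphere c r ⊆ resolventSet ℂ x) :
    IsIdempotentElem (rieszProjector x c r) := by
  obtain ⟨r', hr', hU⟩ :=
    exists_closedBall_diff_ball_subset hr (spectrum.isOpen_resolventSet (𝕜 := ℂ) x) hs
  have hr0' : 0 < r' := hr.trans hr'
  have hs' : sphere c r' ⊆ resolventSet ℂ x := fun z hz =>
    hU ⟨sphere_subset_closedBall hz, fun h => by
      rw [mem_sphere] at hz; rw [mem_ball] at h; linarith⟩
  have hout : ∀ z ∈ sphere c r', z ∉ closedBall c r := fun z hz h => by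
    rw [mem_sphere] at hz; rw [mem_closedBall] at h; linarith
  have hrad : rieszProjector x c r' = rieszProjector x c r := by
    rw [rieszProjector, rieszProjector,
      Complex.circleIntegral_eq_of_differentiable_on_annulus_off_countable hr hr'.le
        Set.countable_empty ((continuousOn_resolvent x).mono hU) fun z hz =>
          (spectrum.hasDerivAt_resolvent_const_left (hU ⟨ball_subset_closedBall hz.1.1,
            fun h => hz.1.2 (ball_subset_closedBall h)⟩)).differentiableAt]
  have hmul := (ContinuousLinearMap.mul ℂ A (rieszProjector x c r)).circleIntegral_comp_comm
    (circleIntegrable_resolvent hr0'.le hs')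
  simp only [ContinuousLinearMap.mul_apply'] at hmul
  have hS : ∀ w ∈ sphere c r',
      rieszProjector x c r * resolvent x w = resolventCauchyTransform x c r w := fun w hw => by
    have hw' : IsUnit (algebraMap ℂ A w - x) := hs' hw
    have hcomm : Commute (algebraMap ℂ A w - x) (resolventCauchyTransform x c r w) :=
      (Algebra.commute_algebraMap_left w _).sub_left
        ((Commute.refl x).resolventCauchyTransform_right c r w)
    rw [← sub_mul_resolventCauchyTransform_of_notMem_closedBall hr.le hs (hout w hw), hcomm.eq,
      resolvent, Ring.mul_inverse_cancel_right _ _ hw']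
  have hcont : ContinuousOn (Function.uncurry fun w z : ℂ => (w - z)⁻¹ • resolvent x z)
      (sphere c r' ×ˢ sphere c r) := by
    refine ContinuousOn.smul ?_ ?_
    · exact (continuous_fst.sub continuous_snd).continuousOn.inv₀ fun p hp h =>
        hout p.1 hp.1 ((sub_eq_zero.1 h : p.1 = p.2) ▸ sphere_subset_closedBall hp.2)
    · exact ((continuousOn_resolvent x).mono hs).comp continuousOn_snd fun p hp => hp.2
  have hinner : ∀ z ∈ sphere c r,
      ∮ w in C(c, r'), (w - z)⁻¹ • resolvent x z
        = (2 * (Real.pi : ℂ) * Complex.I) • resolvent x z := fun z hz => by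
    rw [circleIntegral.integral_smul_const, circleIntegral.integral_sub_inv_of_mem_ball]
    rw [mem_sphere] at hz
    rw [mem_ball]; linarith
  calc rieszProjector x c r * rieszProjector x c r
      = rieszProjector x c r * rieszProjector x c r' := by rw [hrad]
    _ = (2 * (Real.pi : ℂ) * Complex.I)⁻¹ •
          ∮ w in C(c, r'), rieszProjector x c r * resolvent x w := by
        rw [hmul, ← mul_smul_comm]; rfl
    _ = (2 * (Real.pi : ℂ) * Complex.I)⁻¹ • ∮ w in C(c, r'), resolventCauchyTransform x c r w := by
        rw [circleIntegral.integral_congr hr0'.le hS]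
    _ = rieszProjector x c r := by
        simp only [resolventCauchyTransform]
        rw [circleIntegral.integral_smul, circleIntegral_circleIntegral_swap hr0'.le hr.le hcont,
          circleIntegral.integral_congr hr.le hinner, circleIntegral.integral_smul,
          inv_smul_smul₀ Complex.two_pi_I_ne_zero]
        rfl

/-- If the circle `C(c, r)` separates the spectrum of `x` along the imaginary axis, with the right
part inside, then the Riesz projector over it is the positive spectral projector. -/
theorem isPosSpectralProj_rieszProjector (hr : 0 < r)
    (hin : ∀ w ∈ closedBall c r, w.re ≤ 0 → w ∈ resolventSet ℂ x)
    (hout : ∀ w ∉ ball c r, 0 ≤ w.re → w ∈ resolventSet ℂ x) :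
    IsPosSpectralProj x (rieszProjector x c r) := by
  have hs : sphere c r ⊆ resolventSet ℂ x := fun w hw =>
    (le_total w.re 0).elim (hin w (sphere_subset_closedBall hw))
      (hout w fun h => (mem_sphere.1 hw).not_lt (mem_ball.1 h))
  have hid := isIdempotentElem_rieszProjector hr hs
  have hcomm : Commute x (rieszProjector x c r) := (Commute.refl x).rieszProjector_right c r
  have hw1 : ∀ w, Commute (algebraMap ℂ A w - x) (rieszProjector x c r) := fun w =>
    (Algebra.commute_algebraMap_left w _).sub_left hcomm
  have hw2 : ∀ w, Commute (algebraMap ℂ A w - x) (1 - rieszProjector x c r) := fun w =>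
    (Commute.one_right _).sub_right (hw1 w)
  have hSx : ∀ w, Commute (algebraMap ℂ A w - x) (resolventCauchyTransform x c r w) := fun w =>
    (Algebra.commute_algebraMap_left w _).sub_left
      ((Commute.refl x).resolventCauchyTransform_right c r w)
  have hSP : ∀ w, Commute (resolventCauchyTransform x c r w) (rieszProjector x c r) := fun w =>
    ((Commute.refl x).resolventCauchyTransform_right c r w).symm.rieszProjector_right c r
  refine ⟨hid, hcomm, fun w hw => ?_, fun w hw => ?_⟩
  · by_cases hwb : w ∈ closedBall c r
    · exact IsUnit.mul_add_compl (hin w hwb hw) hid (hw1 w)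
    · have e := sub_mul_resolventCauchyTransform_of_notMem_closedBall hr.le hs hwb
      exact hid.isUnit_mul_add_compl (hw1 w) (hSP w) (by rw [e, hid.eq])
        (by rw [← (hSx w).eq, e, hid.eq])
  · have e0 : (algebraMap ℂ A w - x) * (1 - rieszProjector x c r) + rieszProjector x c r
        = (algebraMap ℂ A w - x) * (1 - rieszProjector x c r)
          + (1 - (1 - rieszProjector x c r)) := by abel
    rw [e0]
    by_cases hwb : w ∈ ball c r
    · have e := sub_mul_resolventCauchyTransform_of_mem_ball hr.le hs hwb
      have e1 : (rieszProjector x c r - 1) * -(1 - rieszProjector x c r)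
          = 1 - rieszProjector x c r := by
        rw [mul_neg, ← neg_mul, neg_sub, hid.one_sub.eq]
      have hc : Commute (resolventCauchyTransform x c r w) (1 - rieszProjector x c r) :=
        (Commute.one_right _).sub_right (hSP w)
      refine hid.one_sub.isUnit_mul_add_compl (b := -resolventCauchyTransform x c r w) (hw2 w)
        hc.neg_left ?_ ?_
      · rw [mul_neg, e, neg_mul, ← mul_neg, e1]
      · rw [neg_mul, ← (hSx w).eq, e, neg_mul, ← mul_neg, e1]
    · exact IsUnit.mul_add_compl (hout w hwb hw) hid.one_sub (hw2 w)

end Riesz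

section Continuity

open Metric Filter Topology

variable {A : Type*} [NormedRing A] [NormedAlgebra ℂ A]

theorem mem_hypSet_iff {x : A} :
    x ∈ hypSet A ↔ ∀ z : ℂ, z.re = 0 → IsUnit (algebraMap ℂ A z - x) := by
  simp only [hypSet, Set.mem_ofPred_eq, Set.eq_empty_iff_forall_notMem, Set.mem_inter_iff, not_and]
  exact forall_congr' fun z => ⟨fun h hz => by simpa [spectrum.mem_iff] using fun h' => h h' hz,
    fun h h' hz => (spectrum.mem_iff.1 h') (h hz)⟩

/-- A compact subset of the open right half-plane lies in a disc tangent to the imaginary axis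
at the origin. -/
theorem IsCompact.exists_subset_ball_self {K : Set ℂ} (hK : IsCompact K)
    (hpos : ∀ z ∈ K, 0 < z.re) : ∃ c : ℝ, 0 < c ∧ K ⊆ ball (c : ℂ) c := by
  obtain ⟨M, hM⟩ := (hK.image_of_continuousOn (f := fun z : ℂ => Complex.normSq z / (2 * z.re))
    (Complex.continuous_normSq.continuousOn.div (by fun_prop)
      fun z hz => (mul_pos two_pos (hpos z hz)).ne')).bddAbove
  refine ⟨|M| + 1, by positivity, fun z hz => ?_⟩
  have h1 : Complex.normSq z / (2 * z.re) ≤ M := hM ⟨z, hz, rfl⟩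
  have h2 : 0 < 2 * z.re := mul_pos two_pos (hpos z hz)
  have h3 : Complex.normSq z < (|M| + 1) * (2 * z.re) :=
    (div_lt_iff₀ h2).1 (by linarith [le_abs_self M])
  rw [mem_ball, dist_eq_norm, ← sq_lt_sq₀ (norm_nonneg _) (by positivity),
    ← Complex.normSq_eq_norm_sq]
  rw [Complex.normSq_apply] at h3 ⊢
  simp only [Complex.sub_re, Complex.sub_im, Complex.ofReal_re, Complex.ofReal_im]
  nlinarith

theorem eq_zero_of_mem_closedBall_self {c : ℝ} {z : ℂ} (hc : 0 < c)
    (hz : z ∈ closedBall (c : ℂ) c) (hre : z.re ≤ 0) : z = 0 := by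
  rw [mem_closedBall, dist_eq_norm, ← sq_le_sq₀ (norm_nonneg _) hc.le,
    ← Complex.normSq_eq_norm_sq, Complex.normSq_apply] at hz
  simp only [Complex.sub_re, Complex.sub_im, Complex.ofReal_re, Complex.ofReal_im] at hz
  have h : 0 ≤ c * (-z.re) := mul_nonneg hc.le (by linarith)
  refine Complex.ext ?_ ?_
  · exact pow_eq_zero_iff two_ne_zero |>.1 (by nlinarith [sq_nonneg z.re, sq_nonneg z.im])
  · exact pow_eq_zero_iff two_ne_zero |>.1 (by nlinarith [sq_nonneg z.re, sq_nonneg z.im])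

variable {x : A}

theorem resolventSet_of_circle (hx : x ∈ hypSet A) {c r : ℝ}
    (h1 : spectrum ℂ x ∩ {z : ℂ | 0 < z.re} ⊆ ball (c : ℂ) r)
    (h2 : Disjoint (spectrum ℂ x ∩ {z : ℂ | z.re ≤ 0}) (closedBall (c : ℂ) r)) :
    (∀ w ∈ closedBall (c : ℂ) r, w.re ≤ 0 → w ∈ resolventSet ℂ x) ∧
      ∀ w ∉ ball (c : ℂ) r, 0 ≤ w.re → w ∈ resolventSet ℂ x := by
  refine ⟨fun w hw hre => by_contra fun h => Set.disjoint_left.1 h2 ⟨h, hre⟩ hw,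
    fun w hw hre => ?_⟩
  rcases hre.eq_or_lt with h | h
  · exact mem_hypSet_iff.1 hx w h.symm
  · exact by_contra fun h' => hw (h1 ⟨h', h⟩)

theorem IsPosSpectralProj.mem_hypSet {p : A} (h : IsPosSpectralProj x p) : x ∈ hypSet A := by
  refine mem_hypSet_iff.2 fun z hz => ?_
  simpa using h.isUnit_sub_segment le_rfl zero_le_one hz

variable [CompleteSpace A]

theorem exists_circle_of_mem_hypSet (hx : x ∈ hypSet A) :
    ∃ c r : ℝ, 0 < r ∧ spectrum ℂ x ∩ {z : ℂ | 0 < z.re} ⊆ ball (c : ℂ) r ∧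
      Disjoint (spectrum ℂ x ∩ {z : ℂ | z.re ≤ 0}) (closedBall (c : ℂ) r) := by
  rw [mem_hypSet_iff] at hx
  have hK : IsCompact (spectrum ℂ x ∩ {z : ℂ | 0 ≤ z.re}) :=
    (spectrum.isCompact x).inter_right (isClosed_le continuous_const Complex.continuous_re)
  obtain ⟨c, hc, hKc⟩ := hK.exists_subset_ball_self fun z hz =>
    lt_of_le_of_ne hz.2 fun h => hz.1 (hx z h.symm)
  refine ⟨c, c, hc, fun z hz => hKc ⟨hz.1, (show 0 < z.re from hz.2).le⟩,
    Set.disjoint_left.2 fun z hz hzc => ?_⟩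
  obtain rfl := eq_zero_of_mem_closedBall_self hc hzc hz.2
  exact hz.1 (hx 0 rfl)

theorem isPosSpectralProj_posProj_and_commute_posProj (hx : x ∈ hypSet A) :
    IsPosSpectralProj x (posProj x) ∧ ∀ b, Commute b x → Commute b (posProj x) := by
  have h := exists_circle_of_mem_hypSet hx
  rw [posProj, dif_pos h]
  obtain ⟨hr, h1, h2⟩ := h.choose_spec.choose_spec
  obtain ⟨hin, hout⟩ := resolventSet_of_circle hx h1 h2
  exact ⟨isPosSpectralProj_rieszProjector hr hin hout, fun b hb => hb.rieszProjector_right _ _⟩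

theorem isPosSpectralProj_posProj (hx : x ∈ hypSet A) : IsPosSpectralProj x (posProj x) :=
  (isPosSpectralProj_posProj_and_commute_posProj hx).1

theorem IsPosSpectralProj.posProj_eq {p : A} (h : IsPosSpectralProj x p) : posProj x = p :=
  (isPosSpectralProj_posProj h.mem_hypSet).eq_of_commute h
    ((isPosSpectralProj_posProj_and_commute_posProj h.mem_hypSet).2 p h.comm.symm).symm

theorem continuousAt_uncurry_resolvent {z : ℂ} (hz : z ∈ resolventSet ℂ x) :
    ContinuousAt (fun q : A × ℂ => resolvent q.1 q.2) (x, z) := by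
  have h : ContinuousAt Ring.inverse (algebraMap ℂ A z - x) := by
    obtain ⟨u, hu⟩ : IsUnit (algebraMap ℂ A z - x) := hz
    rw [← hu]
    exact NormedRing.inverse_continuousAt u
  exact h.comp (f := fun q : A × ℂ => algebraMap ℂ A q.2 - q.1) (x := (x, z))
    (((continuous_algebraMap ℂ A).comp continuous_snd).sub continuous_fst).continuousAt

theorem eventually_subset_resolventSet {K : Set ℂ} (hK : IsCompact K)
    (h : K ⊆ resolventSet ℂ x) : ∀ᶠ y in 𝓝 x, K ⊆ resolventSet ℂ y := by
  refine hK.eventually_forall_of_forall_eventually fun z hz => ?_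
  have hc : Continuous fun q : A × ℂ => algebraMap ℂ A q.2 - q.1 :=
    ((continuous_algebraMap ℂ A).comp continuous_snd).sub continuous_fst
  exact (Units.isOpen.preimage hc).mem_nhds (h hz)

theorem continuousAt_rieszProjector {c : ℂ} {r : ℝ} (hr : 0 ≤ r)
    (hs : sphere c r ⊆ resolventSet ℂ x) : ContinuousAt (fun y => rieszProjector y c r) x := by
  refine ContinuousAt.const_smul ?_ _
  rw [ContinuousAt, Metric.tendsto_nhds]
  intro ε hε
  obtain ⟨δ, hδ, hδε⟩ : ∃ δ > 0, 2 * Real.pi * r * δ < ε :=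
    ⟨ε / (2 * Real.pi * r + 1), by positivity, by
      rw [mul_div_assoc', div_lt_iff₀ (by positivity)]; nlinarith⟩
  have hclose : ∀ᶠ y in 𝓝 x, ∀ z ∈ sphere c r, ‖resolvent y z - resolvent x z‖ ≤ δ := by
    refine (isCompact_sphere c r).eventually_forall_of_forall_eventually fun z hz => ?_
    have h1 := continuousAt_uncurry_resolvent (hs hz)
    have h2 : ContinuousAt (fun q : A × ℂ => resolvent x q.2) (x, z) :=
      ContinuousAt.comp (g := resolvent x) (f := fun q : A × ℂ => q.2)
        (spectrum.hasDerivAt_resolvent_const_left (hs hz)).continuousAt continuousAt_snd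
    have h3 := (h1.sub h2).norm
    have h4 : (fun q : A × ℂ => ‖resolvent q.1 q.2 - resolvent x q.2‖) (x, z) < δ := by
      simpa using hδ
    exact (h3.eventually_lt continuousAt_const h4).mono fun q hq => le_of_lt hq
  filter_upwards [hclose, eventually_subset_resolventSet (isCompact_sphere c r) hs] with y hy hys
  rw [dist_eq_norm, ← circleIntegral.integral_sub (circleIntegrable_resolvent hr hys)
    (circleIntegrable_resolvent hr hs)]
  exact (circleIntegral.norm_integral_le_of_norm_le_const hr hy).trans_lt hδε

theorem continuousAt_posProj (hx : x ∈ hypSet A) : ContinuousAt (posProj : A → A) x := by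
  obtain ⟨c, r, hr, h1, h2⟩ := exists_circle_of_mem_hypSet hx
  obtain ⟨hin, hout⟩ := resolventSet_of_circle hx h1 h2
  have hs : sphere (c : ℂ) r ⊆ resolventSet ℂ x := fun w hw =>
    (le_total w.re 0).elim (hin w (sphere_subset_closedBall hw))
      (hout w fun h => (mem_sphere.1 hw).not_lt (mem_ball.1 h))
  refine (continuousAt_rieszProjector hr.le hs).congr ?_
  have hK1 : IsCompact (closedBall (c : ℂ) r ∩ {z : ℂ | z.re ≤ 0}) :=
    (isCompact_closedBall _ _).inter_right (isClosed_le Complex.continuous_re continuous_const)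
  have hK2 : IsCompact ((closedBall (0 : ℂ) ((‖x‖ + 1) * ‖(1 : A)‖) \ ball (c : ℂ) r) ∩
      {z : ℂ | 0 ≤ z.re}) :=
    ((isCompact_closedBall _ _).diff isOpen_ball).inter_right
      (isClosed_le continuous_const Complex.continuous_re)
  filter_upwards [eventually_subset_resolventSet hK1 fun z hz => hin z hz.1 hz.2,
    eventually_subset_resolventSet hK2 fun z hz => hout z hz.1.2 hz.2,
    continuous_norm.continuousAt.eventually_lt continuousAt_const (lt_add_one ‖x‖)]
    with y hy1 hy2 hy
  refine (isPosSpectralProj_rieszProjector hr (fun w hw hre => hy1 ⟨hw, hre⟩)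
    fun w hw hre => ?_).posProj_eq.symm
  by_cases hwb : w ∈ closedBall (0 : ℂ) ((‖x‖ + 1) * ‖(1 : A)‖)
  · exact hy2 ⟨⟨hwb, hw⟩, hre⟩
  · by_contra hwy
    exact hwb (closedBall_subset_closedBall (by gcongr) (spectrum.subset_closedBall_norm_mul y hwy))

end Continuity

/-- The map `p⁺` is a homotopy equivalence from the space of hyperbolic elements to the
space of idempotents, with homotopy inverse `p ↦ 2p - 1`. -/
theorem posProj_homotopy_equivalence
    (A : Type*) [NormedRing A] [NormedAlgebra ℂ A] [CompleteSpace A] :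
    ∃ (f : C(↥(hypSet A), ↥(idemSet A))) (g : C(↥(idemSet A), ↥(hypSet A))),
      (∀ x : ↥(hypSet A), (f x : A) = posProj (x : A)) ∧
      (∀ p : ↥(idemSet A), (g p : A) = (2 : ℂ) • (p : A) - 1) ∧
      (f.comp g).Homotopic (ContinuousMap.id _) ∧
      (g.comp f).Homotopic (ContinuousMap.id _) := by
  have hproj : ∀ p : ↥(idemSet A), IsPosSpectralProj ((2 : ℂ) • (p : A) - 1) (p : A) := fun p =>
    IsPosSpectralProj.two_smul_sub_one p.2
  let f : C(↥(hypSet A), ↥(idemSet A)) :=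
    ⟨fun x => ⟨posProj (x : A), (isPosSpectralProj_posProj x.2).idem⟩,
      (continuous_iff_continuousAt.2 fun x =>
        (continuousAt_posProj x.2).comp continuous_subtype_val.continuousAt).subtype_mk _⟩
  let g : C(↥(idemSet A), ↥(hypSet A)) :=
    ⟨fun p => ⟨(2 : ℂ) • (p : A) - 1, (hproj p).mem_hypSet⟩, by fun_prop⟩
  have hfg : f.comp g = ContinuousMap.id _ :=
    ContinuousMap.ext fun p => Subtype.ext (hproj p).posProj_eq
  refine ⟨f, g, fun _ => rfl, fun _ => rfl, hfg ▸ ContinuousMap.Homotopic.refl _, ?_⟩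
  have hmem (t : unitInterval) (x : ↥(hypSet A)) :
      ((1 - t : ℝ) : ℂ) • (x : A) + ((t : ℝ) : ℂ) • ((2 : ℂ) • (f x : A) - 1) ∈ hypSet A :=
    mem_hypSet_iff.2 fun z hz =>
      (isPosSpectralProj_posProj x.2).isUnit_sub_segment t.2.1 t.2.2 hz
  exact ContinuousMap.Homotopic.symm ⟨{
    toFun := fun q => ⟨_, hmem q.1 q.2⟩
    continuous_toFun := by fun_prop
    map_zero_left := fun x => Subtype.ext (by simp)
    map_one_left := fun x => Subtype.ext (by simp [g]) }⟩
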